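/- Let a, b > 0 satisfy the nine inequalities 2a + b ≥ 1, 3a + 4b ≥ 2, 9a + 11b ≥ 6, a + 5b ≥ 1, 4a + 9b ≥ 3, 10a + 16b ≥ 7, 13a + 20b ≥ 8, 5a + 14b ≥ 4, a + (3/2)b ≥ 2/3. Let G be a graph with no triangle adjacent to a 4-cycle such that α(G) < |V(G)| − (a|V(G)| + b|E(G)| + bλ(G)), and suppose every graph G' with fewer vertices than G and no triangle adjacent to a 4-cycle satisfies α(G') ≥ |V(G')| − (a|V(G')| + b|E(G')| + bλ(G')). Then the minimum degree of G is at least three. -/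

import Mathlib

namespace Paper

/-- `s` is an independent set in the simple graph `G`. -/
def IsIndepSet {V : Type} (G : SimpleGraph V) (s : Finset V) : Prop :=
  ∀ v ∈ s, ∀ w ∈ s, ¬ G.Adj v w

/-- The independence number `α(G)`: the size of a largest independent set. -/
noncomputable def indepNum {V : Type} (G : SimpleGraph V) : ℕ :=
  sSup {n | ∃ s : Finset V, IsIndepSet G s ∧ s.card = n}

/-- The number of edges `|E(G)|`. -/
noncomputable def numEdges {V : Type} (G : SimpleGraph V) : ℕ :=
  Nat.card G.edgeSet

/-- The degree of a vertex. -/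
noncomputable def deg {V : Type} (G : SimpleGraph V) (v : V) : ℕ :=
  Nat.card (G.neighborSet v)

/-- `G` contains a triangle sharing a common edge with a 4-cycle:
the triangle `u v w` and the 4-cycle `u v x y` share the edge `u v`. -/
def HasTriangleAdjC4 {V : Type} (G : SimpleGraph V) : Prop :=
  ∃ u v w x y : V, G.Adj u v ∧ G.Adj v w ∧ G.Adj w u ∧
    G.Adj v x ∧ G.Adj x y ∧ G.Adj y u ∧ u ≠ x ∧ v ≠ y

/-- `G` contains two triangles sharing a common edge:
the triangles `u v w` and `u v x` share the edge `u v`. -/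
def HasAdjTriangles {V : Type} (G : SimpleGraph V) : Prop :=
  ∃ u v w x : V, G.Adj u v ∧ G.Adj v w ∧ G.Adj w u ∧
    G.Adj v x ∧ G.Adj x u ∧ w ≠ x

/-- `G` contains a triangle sharing a common edge with a 5-cycle:
the triangle `u v w` and the 5-cycle `u v x y z` share the edge `u v`. -/
def HasTriangleAdjC5 {V : Type} (G : SimpleGraph V) : Prop :=
  ∃ u v w x y z : V, G.Adj u v ∧ G.Adj v w ∧ G.Adj w u ∧
    G.Adj v x ∧ G.Adj x y ∧ G.Adj y z ∧ G.Adj z u ∧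
    u ≠ x ∧ u ≠ y ∧ v ≠ y ∧ v ≠ z ∧ x ≠ z

/-- The 2-chain of triangles: two disjoint triangles `{0,1,2}` and `{3,4,5}`
joined by the single edge `{2,3}` (6 vertices, 7 edges). -/
def chainGraph : SimpleGraph (Fin 6) :=
  SimpleGraph.fromRel (fun i j =>
    (i.val, j.val) ∈ [(0,1), (0,2), (1,2), (3,4), (3,5), (4,5), (2,3)])

/-- A connected component is difficult if it is a triangle or a 2-chain of triangles. -/
def IsDifficult {V : Type} (G : SimpleGraph V) (c : G.ConnectedComponent) : Prop :=
  Nonempty (SimpleGraph.induce c.supp G ≃g (⊤ : SimpleGraph (Fin 3))) ∨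
  Nonempty (SimpleGraph.induce c.supp G ≃g chainGraph)

/-- `λ(G)`: the number of difficult components of `G`. -/
noncomputable def lambda {V : Type} (G : SimpleGraph V) : ℕ :=
  Nat.card {c : G.ConnectedComponent // IsDifficult G c}

/-- `Φ(S)`: the number of edges of `G` with exactly one endpoint in `S`. -/
noncomputable def phi {V : Type} (G : SimpleGraph V) (S : Set V) : ℕ :=
  Nat.card {e : Sym2 V | e ∈ G.edgeSet ∧ ∃ x ∈ S, ∃ y, y ∉ S ∧ e = s(x, y)}

section Basic

open SimpleGraph

variable {V : Type} {G : SimpleGraph V}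

/-- The ordered pairs `(x, y)` with `x ∈ X`, `y ∉ X` that span an edge of `G`. -/
def boundary (G : SimpleGraph V) (X : Set V) : Set (V × V) :=
  {p | p.1 ∈ X ∧ p.2 ∉ X ∧ G.Adj p.1 p.2}

lemma bddAbove_card_isIndepSet [Finite V] (G : SimpleGraph V) :
    BddAbove {n | ∃ s : Finset V, IsIndepSet G s ∧ s.card = n} := by
  have := Fintype.ofFinite V
  refine ⟨Fintype.card V, ?_⟩
  rintro n ⟨s, -, rfl⟩
  exact Finset.card_le_univ s

lemma IsIndepSet.card_le_indepNum [Finite V] {s : Finset V} (hs : IsIndepSet G s) :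
    s.card ≤ indepNum G :=
  le_csSup (bddAbove_card_isIndepSet G) ⟨s, hs, rfl⟩

lemma exists_isIndepSet_card_eq_indepNum [Finite V] (G : SimpleGraph V) :
    ∃ s : Finset V, IsIndepSet G s ∧ s.card = indepNum G :=
  Nat.sSup_mem (s := {n | ∃ s : Finset V, IsIndepSet G s ∧ s.card = n})
    ⟨0, ∅, by simp [IsIndepSet], rfl⟩ (bddAbove_card_isIndepSet G)

lemma card_add_indepNum_induce_compl_le [Finite V] {A : Finset V} {X : Set V}
    (hA : IsIndepSet G A) (hAX : ↑A ⊆ X) (hN : ∀ v ∈ A, ∀ w, G.Adj v w → w ∈ X) :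
    A.card + indepNum (G.induce Xᶜ) ≤ indepNum G := by
  classical
  obtain ⟨s, hs, hcard⟩ := exists_isIndepSet_card_eq_indepNum (G.induce Xᶜ)
  have hdisj : Disjoint A (s.map (Function.Embedding.subtype _)) := by
    rw [Finset.disjoint_left]
    intro v hv hv'
    obtain ⟨w, -, rfl⟩ := Finset.mem_map.1 hv'
    exact w.2 (hAX hv)
  rw [← hcard, ← Finset.card_map (Function.Embedding.subtype _),
    ← Finset.card_union_of_disjoint hdisj]
  apply IsIndepSet.card_le_indepNum
  intro v hv w hw hvw
  rw [Finset.mem_union] at hv hw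
  rcases hv with hv | hv <;> rcases hw with hw | hw
  · exact hA v hv w hw hvw
  · obtain ⟨w, -, rfl⟩ := Finset.mem_map.1 hw
    exact w.2 (hN v hv _ hvw)
  · obtain ⟨v, -, rfl⟩ := Finset.mem_map.1 hv
    exact v.2 (hN w hw _ hvw.symm)
  · obtain ⟨w, hw', rfl⟩ := Finset.mem_map.1 hw
    obtain ⟨v, hv', rfl⟩ := Finset.mem_map.1 hv
    exact hs v hv' w hw' hvw

lemma indepNum_add_indepNum_le [Finite V] {X : Set V}
    (hX : ∀ v ∈ X, ∀ w, G.Adj v w → w ∈ X) :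
    indepNum (G.induce X) + indepNum (G.induce Xᶜ) ≤ indepNum G := by
  obtain ⟨s, hs, hcard⟩ := exists_isIndepSet_card_eq_indepNum (G.induce X)
  rw [← hcard, ← Finset.card_map (Function.Embedding.subtype _)]
  apply card_add_indepNum_induce_compl_le
  · intro v hv w hw hvw
    obtain ⟨w, hw', rfl⟩ := Finset.mem_map.1 hw
    obtain ⟨v, hv', rfl⟩ := Finset.mem_map.1 hv
    exact hs v hv' w hw' hvw
  · intro v hv
    obtain ⟨v, -, rfl⟩ := Finset.mem_map.1 hv
    exact v.2
  · intro v hv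
    obtain ⟨v, -, rfl⟩ := Finset.mem_map.1 hv
    exact hX v v.2

lemma mem_edgeSet_and_forall_mem_of_mem_image {X : Set V} {e : Sym2 V}
    (he : e ∈ Sym2.map Subtype.val '' (G.induce X).edgeSet) :
    e ∈ G.edgeSet ∧ ∀ x ∈ e, x ∈ X := by
  obtain ⟨e, he, rfl⟩ := he
  induction e with | _ x y =>
  exact ⟨he, by simp⟩

lemma numEdges_induce_add_le [Finite V] (G : SimpleGraph V) (X : Set V) :
    numEdges (G.induce X) + numEdges (G.induce Xᶜ) + (boundary G X).ncard ≤ numEdges G := by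
  have hcard (Y : Set V) : numEdges (G.induce Y) =
      (Sym2.map Subtype.val '' (G.induce Y).edgeSet).ncard :=
    (Set.ncard_image_of_injective _ (Sym2.map.injective Subtype.val_injective)).symm
  have hB : (boundary G X).ncard = ((fun p : V × V => s(p.1, p.2)) '' boundary G X).ncard := by
    refine (Set.InjOn.ncard_image ?_).symm
    rintro ⟨x, y⟩ ⟨hx, hy, -⟩ ⟨x', y'⟩ ⟨hx', hy', -⟩ h
    rcases Sym2.eq_iff.1 h with ⟨h1, h2⟩ | ⟨h1, h2⟩
    · exact Prod.ext h1 h2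
    · exact absurd (h1 ▸ hx) hy'
  rw [hcard, hcard, hB, ← Set.ncard_union_eq, ← Set.ncard_union_eq]
  · refine Set.ncard_le_ncard ?_
    rintro e ((he | he) | ⟨p, hp, rfl⟩)
    · exact (mem_edgeSet_and_forall_mem_of_mem_image he).1
    · exact (mem_edgeSet_and_forall_mem_of_mem_image he).1
    · exact hp.2.2
  · rw [Set.disjoint_left]
    rintro _ (he | he) ⟨p, hp, rfl⟩
    · exact hp.2.1 ((mem_edgeSet_and_forall_mem_of_mem_image he).2 _ (Sym2.mem_mk_right _ _))
    · exact (mem_edgeSet_and_forall_mem_of_mem_image he).2 _ (Sym2.mem_mk_left _ _) hp.1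
  · rw [Set.disjoint_left]
    intro e he he'
    induction e with | _ x y =>
    exact (mem_edgeSet_and_forall_mem_of_mem_image he').2 x (Sym2.mem_mk_left _ _)
      ((mem_edgeSet_and_forall_mem_of_mem_image he).2 x (Sym2.mem_mk_left _ _))

lemma card_le_numEdges_induce [Finite V] {X : Set V} (F : Finset (Sym2 V))
    (hF : ∀ e ∈ F, e ∈ G.edgeSet ∧ ∀ x ∈ e, x ∈ X) : F.card ≤ numEdges (G.induce X) := by
  rw [← Set.ncard_coe_finset]
  refine (Set.ncard_le_ncard ?_).trans
    (Set.ncard_image_le (f := Sym2.map Subtype.val) (s := (G.induce X).edgeSet))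
  intro e he
  obtain ⟨hG, hX⟩ := hF e he
  induction e with | _ x y =>
  exact ⟨s(⟨x, hX x (Sym2.mem_mk_left _ _)⟩, ⟨y, hX y (Sym2.mem_mk_right _ _)⟩), hG, rfl⟩

/-- A set of vertices of `G` inducing a difficult graph with no edge leaving the set. -/
def IsDifficultSet (G : SimpleGraph V) (D : Set V) : Prop :=
  (∀ x ∈ D, ∀ y, G.Adj x y → y ∈ D) ∧
    (Nonempty (G.induce D ≃g (⊤ : SimpleGraph (Fin 3))) ∨ Nonempty (G.induce D ≃g chainGraph))

instance : DecidableRel chainGraph.Adj := by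
  unfold chainGraph
  infer_instance

lemma chainGraph_connected : chainGraph.Connected := by
  have h (i : Fin 6) : chainGraph.Reachable 2 i := by
    have h20 : chainGraph.Adj 2 0 := by decide
    have h21 : chainGraph.Adj 2 1 := by decide
    have h23 : chainGraph.Adj 2 3 := by decide
    have h34 : chainGraph.Adj 3 4 := by decide
    have h35 : chainGraph.Adj 3 5 := by decide
    fin_cases i
    · exact h20.reachable
    · exact h21.reachable
    · exact Reachable.refl _
    · exact h23.reachable
    · exact h23.reachable.trans h34.reachable
    · exact h23.reachable.trans h35.reachable
  exact ⟨fun i j => (h i).symm.trans (h j)⟩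

lemma IsDifficultSet.connected {D : Set V} (hD : IsDifficultSet G D) :
    (G.induce D).Connected := by
  rcases hD.2 with ⟨⟨e⟩⟩ | ⟨⟨e⟩⟩
  · exact e.connected_iff.2 connected_top
  · exact e.connected_iff.2 chainGraph_connected

lemma supp_closed (c : G.ConnectedComponent) : ∀ x ∈ c.supp, ∀ y, G.Adj x y → y ∈ c.supp :=
  fun _ hx _ hxy => (c.mem_supp_congr_adj hxy).1 hx

lemma mem_of_reachable {D : Set V} (hD : ∀ x ∈ D, ∀ y, G.Adj x y → y ∈ D) {x y : V}
    (hx : x ∈ D) (h : G.Reachable x y) : y ∈ D := by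
  obtain ⟨p⟩ := h
  induction p with
  | nil => exact hx
  | cons h _ ih => exact ih (hD _ hx _ h)

lemma IsDifficultSet.exists_supp_eq {D : Set V} (hD : IsDifficultSet G D) :
    ∃ c : G.ConnectedComponent, IsDifficult G c ∧ c.supp = D := by
  obtain ⟨⟨x, hx⟩⟩ := hD.connected.nonempty
  have : (G.connectedComponentMk x).supp = D := by
    ext y
    rw [ConnectedComponent.mem_supp_iff, ConnectedComponent.eq]
    refine ⟨fun h => mem_of_reachable hD.1 hx h.symm, fun hy => ?_⟩
    exact (hD.connected.preconnected ⟨y, hy⟩ ⟨x, hx⟩).map (Embedding.induce D).toHom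
  refine ⟨_, ?_, this⟩
  rw [IsDifficult, this]
  exact hD.2

lemma lambda_eq_ncard (G : SimpleGraph V) : lambda G = {D | IsDifficultSet G D}.ncard := by
  refine Nat.card_congr (Equiv.ofBijective (fun c => ⟨c.1.supp, supp_closed c.1, c.2⟩) ⟨?_, ?_⟩)
  · intro c d h
    exact Subtype.ext (ConnectedComponent.supp_injective (congrArg Subtype.val h))
  · rintro ⟨D, hD⟩
    obtain ⟨c, hc, rfl⟩ := IsDifficultSet.exists_supp_eq hD
    exact ⟨⟨c, hc⟩, rfl⟩

/-- Restricting an induced subgraph further is the same as inducing on the image. -/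
noncomputable def induceImageIso (G : SimpleGraph V) {X : Set V} (D : Set X) :
    G.induce (Subtype.val '' D) ≃g (G.induce X).induce D where
  toEquiv := (Equiv.Set.image Subtype.val D Subtype.val_injective).symm
  map_rel_iff' := by
    rintro ⟨_, x, hx, rfl⟩ ⟨_, y, hy, rfl⟩
    have hx' : (⟨_, x, hx, rfl⟩ : Subtype.val '' D) =
      Equiv.Set.image Subtype.val D Subtype.val_injective ⟨x, hx⟩ := rfl
    have hy' : (⟨_, y, hy, rfl⟩ : Subtype.val '' D) =
      Equiv.Set.image Subtype.val D Subtype.val_injective ⟨y, hy⟩ := rfl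
    rw [hx', hy', Equiv.symm_apply_apply, Equiv.symm_apply_apply]
    rfl

lemma IsDifficultSet.image_val {X : Set V} (hX : ∀ v ∈ X, ∀ w, G.Adj v w → w ∈ X)
    {D : Set X} (hD : IsDifficultSet (G.induce X) D) :
    IsDifficultSet G (Subtype.val '' D) := by
  refine ⟨?_, ?_⟩
  · rintro _ ⟨x, hx, rfl⟩ y hxy
    exact ⟨⟨y, hX x x.2 y hxy⟩, hD.1 x hx _ hxy, rfl⟩
  · exact hD.2.imp (fun ⟨e⟩ => ⟨(induceImageIso G D).trans e⟩)
      (fun ⟨e⟩ => ⟨(induceImageIso G D).trans e⟩)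

lemma lambda_add_lambda_le [Finite V] {X : Set V} (hX : ∀ v ∈ X, ∀ w, G.Adj v w → w ∈ X) :
    lambda (G.induce X) + lambda (G.induce Xᶜ) ≤ lambda G := by
  have hX' : ∀ v ∈ Xᶜ, ∀ w, G.Adj v w → w ∈ Xᶜ :=
    fun v hv w hvw hw => hv (hX w hw v hvw.symm)
  have hcard (Y : Set V) : lambda (G.induce Y) =
      ((fun D : Set Y => Subtype.val '' D) '' {D | IsDifficultSet (G.induce Y) D}).ncard := by
    rw [lambda_eq_ncard, Set.ncard_image_of_injective _ Subtype.val_injective.image_injective]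
  rw [hcard, hcard, lambda_eq_ncard, ← Set.ncard_union_eq]
  · refine Set.ncard_le_ncard ?_
    rintro _ (⟨D, hD, rfl⟩ | ⟨D, hD, rfl⟩)
    · exact hD.image_val hX
    · exact hD.image_val hX'
  · rw [Set.disjoint_left]
    rintro _ ⟨D, hD, rfl⟩ ⟨D', hD', h⟩
    obtain ⟨⟨x, hx⟩⟩ := hD.connected.nonempty
    obtain ⟨y, -, hy⟩ := h.ge ⟨x, hx, rfl⟩
    exact y.2 (hy ▸ x.2)

lemma one_le_lambda [Finite V] {D : Set V} (hD : IsDifficultSet G D) : 1 ≤ lambda G := by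
  rw [lambda_eq_ncard]
  exact (Set.ncard_pos).2 ⟨D, hD⟩

lemma mul_lambda_induce_compl_le [Finite V] {X : Set V} {m : ℕ}
    (h : ∀ D : Set ↥Xᶜ, IsDifficultSet (G.induce Xᶜ) D →
      ∃ f : Fin m → V × V, f.Injective ∧ ∀ i, f i ∈ boundary G X ∧ (f i).2 ∈ Subtype.val '' D) :
    m * lambda (G.induce Xᶜ) ≤ (boundary G X).ncard := by
  have hc (c : {c // IsDifficult (G.induce Xᶜ) c}) := h c.1.supp ⟨supp_closed c.1, c.2⟩
  choose f hinj hf using hc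
  rw [mul_comm, lambda, ← Nat.card_fin m, ← Nat.card_prod, ← Nat.card_coe_set_eq]
  refine Nat.card_le_card_of_injective (fun p => ⟨f p.1 p.2, (hf p.1 p.2).1⟩) ?_
  rintro ⟨c, i⟩ ⟨d, j⟩ hij
  have hij : f c i = f d j := congrArg Subtype.val hij
  obtain ⟨y, hy, hye⟩ := (hf c i).2
  obtain ⟨z, hz, hze⟩ := (hf d j).2
  obtain rfl : y = z := Subtype.ext (by rw [hye, hze, hij])
  obtain rfl : c = d := Subtype.ext (hy.symm.trans hz)
  rw [hinj c hij]

lemma not_hasTriangleAdjC4_induce (hG : ¬ HasTriangleAdjC4 G) (X : Set V) :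
    ¬ HasTriangleAdjC4 (G.induce X) := by
  rintro ⟨u, v, w, x, y, h1, h2, h3, h4, h5, h6, h7, h8⟩
  exact hG ⟨u, v, w, x, y, h1, h2, h3, h4, h5, h6, fun h => h7 (Subtype.ext h),
    fun h => h8 (Subtype.ext h)⟩

end Basic

section Param

open SimpleGraph

variable {V ι : Type} {G : SimpleGraph V} {K : SimpleGraph ι}

lemma nonempty_iso_induce_iff {D : Set V} :
    Nonempty (G.induce D ≃g K) ↔ ∃ f : K ↪g G, Set.range f = D := by
  constructor
  · rintro ⟨e⟩
    refine ⟨e.symm.toEmbedding.trans (Embedding.induce D), ?_⟩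
    ext x
    constructor
    · rintro ⟨i, rfl⟩
      exact (e.symm i).2
    · intro hx
      exact ⟨e ⟨x, hx⟩, congrArg Subtype.val (e.symm_apply_apply ⟨x, hx⟩)⟩
  · rintro ⟨f, rfl⟩
    exact ⟨RelIso.symm ⟨Equiv.ofInjective f f.injective, f.map_rel_iff⟩⟩

lemma IsDifficultSet.exists_embedding {X : Set V} {D : Set X}
    (hD : IsDifficultSet (G.induce X) D) :
    (∃ f : (⊤ : SimpleGraph (Fin 3)) ↪g G, Set.range f = Subtype.val '' D) ∨
      ∃ f : chainGraph ↪g G, Set.range f = Subtype.val '' D := by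
  rw [← nonempty_iso_induce_iff, ← nonempty_iso_induce_iff]
  exact hD.2.imp (fun ⟨e⟩ => ⟨(induceImageIso G D).trans e⟩)
    (fun ⟨e⟩ => ⟨(induceImageIso G D).trans e⟩)

lemma mem_or_mem_boundary {X : Set V} {D : Set ↥Xᶜ} (hD : IsDifficultSet (G.induce Xᶜ) D)
    {y n : V} (hy : y ∈ Subtype.val '' D) (hyn : G.Adj y n) :
    n ∈ Subtype.val '' D ∨ (n, y) ∈ boundary G X := by
  obtain ⟨y, hy, rfl⟩ := hy
  by_cases hn : n ∈ X
  · exact Or.inr ⟨hn, y.2, hyn.symm⟩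
  · exact Or.inl ⟨⟨n, hn⟩, hD.1 y hy _ hyn, rfl⟩

lemma numEdges_le_of_embedding [Finite V] (f : K ↪g G) : numEdges K ≤ numEdges G :=
  Nat.card_le_card_of_injective _ f.mapEdgeSet.injective

lemma numEdges_chainGraph : numEdges chainGraph = 7 := by
  rw [numEdges, Nat.card_eq_fintype_card, ← edgeFinset_card]
  decide

/-- Three pairwise adjacent vertices as a copy of the triangle. -/
def triangleEmbedding {p q r : V} (hpq : G.Adj p q) (hpr : G.Adj p r) (hqr : G.Adj q r) :
    (⊤ : SimpleGraph (Fin 3)) ↪g G where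
  toFun := ![p, q, r]
  inj' := by
    intro i j
    fin_cases i <;> fin_cases j <;>
      simp [hpq.ne, hpr.ne, hqr.ne, hpq.ne', hpr.ne', hqr.ne']
  map_rel_iff' := by
    intro i j
    change G.Adj (![p, q, r] i) (![p, q, r] j) ↔ _
    fin_cases i <;> fin_cases j <;> simp [hpq, hpr, hqr, hpq.symm, hpr.symm, hqr.symm]

lemma range_triangleEmbedding {p q r : V} (hpq : G.Adj p q) (hpr : G.Adj p r)
    (hqr : G.Adj q r) : Set.range (triangleEmbedding hpq hpr hqr) = {p, q, r} := by
  change Set.range ![p, q, r] = _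
  ext x
  simp only [Set.mem_range, Fin.exists_fin_succ, Set.mem_insert_iff, Set.mem_singleton_iff]
  simp [eq_comm]

/-- The triangle `{0, 1, 2}` of the 2-chain. -/
def chainTriangleLeft : (⊤ : SimpleGraph (Fin 3)) ↪g chainGraph :=
  triangleEmbedding (p := 0) (q := 1) (r := 2) (by decide) (by decide) (by decide)

/-- The triangle `{3, 4, 5}` of the 2-chain. -/
def chainTriangleRight : (⊤ : SimpleGraph (Fin 3)) ↪g chainGraph :=
  triangleEmbedding (p := 3) (q := 4) (r := 5) (by decide) (by decide) (by decide)

lemma numEdges_top_fin_three : numEdges (⊤ : SimpleGraph (Fin 3)) = 3 := by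
  rw [numEdges, Nat.card_eq_fintype_card, ← edgeFinset_card]
  decide

lemma three_le_numEdges_induce_range [Finite V] (h : (⊤ : SimpleGraph (Fin 3)) ↪g G) :
    3 ≤ numEdges (G.induce (Set.range h)) := by
  obtain ⟨e⟩ := nonempty_iso_induce_iff.2 ⟨h, rfl⟩
  exact numEdges_top_fin_three.ge.trans (numEdges_le_of_embedding e.symm.toEmbedding)

lemma ncard_range_triangle (h : (⊤ : SimpleGraph (Fin 3)) ↪g G) : (Set.range h).ncard = 3 := by
  rw [← Set.image_univ, Set.ncard_image_of_injective _ h.injective, Set.ncard_univ, Nat.card_fin]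

/-- Relabelling a triangle so that a given vertex gets a given label. -/
lemma exists_triangle_apply_eq (h : (⊤ : SimpleGraph (Fin 3)) ↪g G) (k : Fin 3) {y : V}
    (hy : y ∈ Set.range h) :
    ∃ h' : (⊤ : SimpleGraph (Fin 3)) ↪g G, Set.range h' = Set.range h ∧ h' k = y := by
  obtain ⟨i, rfl⟩ := hy
  refine ⟨(Iso.completeGraph (Equiv.swap k i)).toEmbedding.trans h, ?_, ?_⟩
  · exact (Equiv.swap k i).surjective.range_comp h
  · exact congrArg h (Equiv.swap_apply_left k i)

/-- Two disjoint triangles joined by a single edge form a 2-chain. -/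
def chainEmbedding (h g : (⊤ : SimpleGraph (Fin 3)) ↪g G) (hdisj : ∀ i j, h i ≠ g j)
    (hadj : ∀ i j, G.Adj (h i) (g j) ↔ i = 2 ∧ j = 0) : chainGraph ↪g G where
  toFun := Fin.append h g
  inj' := Fin.append_injective_iff.2 ⟨h.injective, g.injective, hdisj⟩
  map_rel_iff' := by
    intro i j
    change G.Adj (Fin.append h g i) (Fin.append h g j) ↔ _
    induction i using Fin.addCases (m := 3) (n := 3) with
    | left i =>
      induction j using Fin.addCases (m := 3) (n := 3) with
      | left j =>
        rw [Fin.append_left, Fin.append_left, h.map_adj_iff]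
        decide +revert
      | right j =>
        rw [Fin.append_left, Fin.append_right, hadj]
        decide +revert
    | right i =>
      induction j using Fin.addCases (m := 3) (n := 3) with
      | left j =>
        rw [Fin.append_left, Fin.append_right, G.adj_comm, hadj]
        clear hdisj hadj
        decide +revert
      | right j =>
        rw [Fin.append_right, Fin.append_right, g.map_adj_iff]
        clear hdisj hadj
        decide +revert

lemma range_chainEmbedding (h g : (⊤ : SimpleGraph (Fin 3)) ↪g G) (hdisj : ∀ i j, h i ≠ g j)
    (hadj : ∀ i j, G.Adj (h i) (g j) ↔ i = 2 ∧ j = 0) :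
    Set.range (chainEmbedding h g hdisj hadj) = Set.range h ∪ Set.range g := by
  change Set.range (Fin.append h g) = _
  ext x
  constructor
  · rintro ⟨i, rfl⟩
    induction i using Fin.addCases with
    | left i => exact Or.inl ⟨i, (Fin.append_left _ _ i).symm⟩
    | right i => exact Or.inr ⟨i, (Fin.append_right _ _ i).symm⟩
  · rintro (⟨i, rfl⟩ | ⟨i, rfl⟩)
    · exact ⟨_, Fin.append_left _ _ i⟩
    · exact ⟨_, Fin.append_right _ _ i⟩

lemma two_le_indepNum_of_embedding [Finite V] (f : chainGraph ↪g G) : 2 ≤ indepNum G := by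
  have : IsIndepSet G (({0, 3} : Finset (Fin 6)).map f.toEmbedding) := by
    intro v hv w hw
    obtain ⟨i, hi, rfl⟩ := Finset.mem_map.1 hv
    obtain ⟨j, hj, rfl⟩ := Finset.mem_map.1 hw
    have key : ∀ i ∈ ({0, 3} : Finset (Fin 6)), ∀ j ∈ ({0, 3} : Finset (Fin 6)),
      ¬ chainGraph.Adj i j := by decide
    exact fun h => key i hi j hj (f.map_rel_iff.1 h)
  simpa using this.card_le_indepNum

end Param

section MinCounterexample

open SimpleGraph

variable {V : Type} {G : SimpleGraph V} {a b : ℝ}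

/-- `G` is a counterexample with the fewest vertices to the bound
`α(G) ≥ |V(G)| - (a|V(G)| + b|E(G)| + bλ(G))`. -/
structure IsMinCex (a b : ℝ) (G : SimpleGraph V) : Prop where
  a_pos : 0 < a
  b_pos : 0 < b
  free : ¬ HasTriangleAdjC4 G
  lt : (indepNum G : ℝ) < (Nat.card V : ℝ) - (a * Nat.card V + b * numEdges G + b * lambda G)
  min : ∀ (W : Type) [Fintype W] (G' : SimpleGraph W),
    Nat.card W < Nat.card V → ¬ HasTriangleAdjC4 G' →
    (indepNum G' : ℝ) ≥
      (Nat.card W : ℝ) - (a * Nat.card W + b * numEdges G' + b * lambda G')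

namespace IsMinCex

lemma le_indepNum_induce [Finite V] (hc : IsMinCex a b G) {Y : Set V} (hY : Y ≠ Set.univ) :
    (Y.ncard : ℝ) - (a * Y.ncard + b * numEdges (G.induce Y) + b * lambda (G.induce Y)) ≤
      indepNum (G.induce Y) := by
  have := Fintype.ofFinite Y
  refine hc.min Y (G.induce Y) ?_ (not_hasTriangleAdjC4_induce hc.free Y)
  rw [Nat.card_coe_set_eq, ← Set.ncard_univ]
  exact Set.ncard_lt_ncard (Set.ssubset_univ_iff.2 hY)

lemma eq_univ_of_closed [Finite V] (hc : IsMinCex a b G) {X : Set V} (hne : X.Nonempty)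
    (hX : ∀ v ∈ X, ∀ w, G.Adj v w → w ∈ X) : X = Set.univ := by
  by_contra huniv
  have h1 := hc.le_indepNum_induce huniv
  have h2 := hc.le_indepNum_induce (Y := Xᶜ) (Set.compl_ne_univ.2 hne)
  have hα : (indepNum (G.induce X) : ℝ) + indepNum (G.induce Xᶜ) ≤ indepNum G := by
    exact_mod_cast indepNum_add_indepNum_le hX
  have hE : (numEdges (G.induce X) : ℝ) + numEdges (G.induce Xᶜ) ≤ numEdges G := by
    exact_mod_cast le_of_add_le_left (numEdges_induce_add_le G X)
  have hl : (lambda (G.induce X) : ℝ) + lambda (G.induce Xᶜ) ≤ lambda G := by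
    exact_mod_cast lambda_add_lambda_le hX
  have hn : (X.ncard : ℝ) + (Xᶜ).ncard = Nat.card V := by
    exact_mod_cast Set.ncard_add_ncard_compl X
  have h3 := hc.lt
  have h4 := mul_le_mul_of_nonneg_left hE hc.b_pos.le
  have h5 := mul_le_mul_of_nonneg_left hl hc.b_pos.le
  rw [← hn] at h3
  nlinarith

/-- Deleting a set `X` containing an independent set `A` and all its neighbours. -/
lemma reduction [Finite V] (hc : IsMinCex a b G) {A : Finset V} {X : Set V} (hne : X.Nonempty)
    (hA : IsIndepSet G A) (hAX : ↑A ⊆ X) (hN : ∀ v ∈ A, ∀ w, G.Adj v w → w ∈ X) :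
    a * X.ncard + b * numEdges (G.induce X) + b * (boundary G X).ncard + b * lambda G <
      X.ncard - A.card + b * lambda (G.induce Xᶜ) := by
  have h2 := hc.le_indepNum_induce (Y := Xᶜ) (Set.compl_ne_univ.2 hne)
  have hα : (A.card : ℝ) + indepNum (G.induce Xᶜ) ≤ indepNum G := by
    exact_mod_cast card_add_indepNum_induce_compl_le hA hAX hN
  have hE : (numEdges (G.induce X) : ℝ) + numEdges (G.induce Xᶜ) + (boundary G X).ncard ≤
      numEdges G := by
    exact_mod_cast numEdges_induce_add_le G X
  have hn : (X.ncard : ℝ) + (Xᶜ).ncard = Nat.card V := by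
    exact_mod_cast Set.ncard_add_ncard_compl X
  have h3 := hc.lt
  have h4 := mul_le_mul_of_nonneg_left hE hc.b_pos.le
  rw [← hn] at h3
  nlinarith

/-- `reduction` for a single vertex `v`. -/
lemma reduction_singleton [Finite V] (hc : IsMinCex a b G) {v : V} {X : Set V} (hv : v ∈ X)
    (hN : ∀ w, G.Adj v w → w ∈ X) :
    a * X.ncard + b * numEdges (G.induce X) + b * (boundary G X).ncard + b * lambda G <
      X.ncard - 1 + b * lambda (G.induce Xᶜ) := by
  simpa using hc.reduction (A := {v}) ⟨v, hv⟩ (by simp [IsIndepSet]) (by simpa) (by simpa)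

lemma exists_mem_boundary [Finite V] (hc : IsMinCex a b G) {X : Set V} (hne : X.Nonempty)
    {D : Set ↥Xᶜ} (hD : IsDifficultSet (G.induce Xᶜ) D) :
    ∃ p ∈ boundary G X, p.2 ∈ Subtype.val '' D := by
  by_contra! h
  obtain ⟨x, hx⟩ := hne
  have huniv : Subtype.val '' D = Set.univ := by
    refine hc.eq_univ_of_closed ?_ fun v hv w hvw => ?_
    · obtain ⟨⟨y, hy⟩⟩ := hD.connected.nonempty
      exact ⟨y, y, hy, rfl⟩
    · exact (mem_or_mem_boundary hD hv hvw).resolve_right fun hp => h _ hp hv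
  obtain ⟨y, -, hy⟩ := huniv.ge (Set.mem_univ x)
  exact y.2 (hy ▸ hx)

lemma lambda_le_ncard_boundary [Finite V] (hc : IsMinCex a b G) {X : Set V} (hne : X.Nonempty) :
    lambda (G.induce Xᶜ) ≤ (boundary G X).ncard := by
  rw [← one_mul (lambda _)]
  refine mul_lambda_induce_compl_le fun D hD => ?_
  obtain ⟨p, hp, hpD⟩ := hc.exists_mem_boundary hne hD
  exact ⟨fun _ => p, Function.injective_of_subsingleton _, fun _ => ⟨hp, hpD⟩⟩

lemma ncard_boundary_eq_of_triangle [Finite V] (hc : IsMinCex a b G) (hab : 3 * a + 4 * b ≥ 2)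
    (h : (⊤ : SimpleGraph (Fin 3)) ↪g G) {i : Fin 3}
    (hi : ∀ n, G.Adj (h i) n → n ∈ Set.range h) :
    (boundary G (Set.range h)).ncard = lambda (G.induce (Set.range h)ᶜ) ∧
      1 ≤ lambda (G.induce (Set.range h)ᶜ) := by
  have hne : (Set.range h).Nonempty := Set.range_nonempty h
  have hred := hc.reduction_singleton (Set.mem_range_self i) hi
  have hE : (3 : ℝ) ≤ numEdges (G.induce (Set.range h)) := by
    exact_mod_cast three_le_numEdges_induce_range h
  have hle := hc.lambda_le_ncard_boundary hne
  have hE' := mul_le_mul_of_nonneg_left hE hc.b_pos.le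
  rw [ncard_range_triangle h] at hred
  push_cast at hred
  have hlt : ((boundary G (Set.range h)).ncard : ℝ) + lambda G <
      lambda (G.induce (Set.range h)ᶜ) + 1 := by
    refine lt_of_mul_lt_mul_left ?_ hc.b_pos.le
    linarith
  have hlt' : (boundary G (Set.range h)).ncard + lambda G <
      lambda (G.induce (Set.range h)ᶜ) + 1 := by
    exact_mod_cast hlt
  refine ⟨by omega, ?_⟩
  by_contra! h0
  have hB : boundary G (Set.range h) = ∅ := by
    rw [← Set.ncard_eq_zero]
    omega
  have huniv : Set.range h = Set.univ := hc.eq_univ_of_closed hne fun v hv w hvw => by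
    by_contra hw
    exact (hB ▸ (⟨hv, hw, hvw⟩ : (v, w) ∈ boundary G (Set.range h)) : (v, w) ∈ (∅ : Set _))
  have : 1 ≤ lambda G :=
    one_le_lambda (D := Set.range h) ⟨fun _ _ y _ => huniv ▸ Set.mem_univ y,
      Or.inl (nonempty_iso_induce_iff.2 ⟨h, rfl⟩)⟩
  omega

/-- No triangle is attached to the rest of the graph by at most one edge. -/
lemma not_leaf_triangle [Finite V] (hc : IsMinCex a b G) (hab : 3 * a + 4 * b ≥ 2)
    (hab' : 9 * a + 11 * b ≥ 6) (h : (⊤ : SimpleGraph (Fin 3)) ↪g G) (y z : V)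
    (hleaf : ∀ i n, G.Adj (h i) n → n ∈ Set.range h ∨ n = z ∧ h i = y) : False := by
  obtain ⟨i, hiy⟩ : ∃ i, h i ≠ y := by
    by_contra! hy
    exact absurd (h.injective ((hy 0).trans (hy 1).symm)) (by decide)
  have hi (n : V) (hn : G.Adj (h i) n) : n ∈ Set.range h :=
    (hleaf i n hn).resolve_right fun h' => hiy h'.2
  obtain ⟨hB, hl⟩ := hc.ncard_boundary_eq_of_triangle hab h hi
  have hsub : boundary G (Set.range h) ⊆ {(y, z)} := by
    rintro ⟨_, n⟩ ⟨⟨j, rfl⟩, hn, hadj⟩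
    obtain ⟨rfl, rfl⟩ := (hleaf j n hadj).resolve_left hn
    rfl
  have hB1 := Set.ncard_le_ncard hsub
  rw [Set.ncard_singleton] at hB1
  rw [lambda_eq_ncard] at hl
  obtain ⟨D, hD : IsDifficultSet _ D⟩ := (Set.ncard_pos).1 hl
  rw [← lambda_eq_ncard] at hl
  obtain ⟨p, hp, hpD⟩ := hc.exists_mem_boundary (Set.range_nonempty h) hD
  obtain rfl := hsub hp
  have huniv : Set.range h ∪ Subtype.val '' D = Set.univ := by
    refine hc.eq_univ_of_closed ⟨h i, Or.inl ⟨i, rfl⟩⟩ ?_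
    rintro v (⟨j, rfl⟩ | hv) w hvw
    · rcases hleaf j w hvw with hw | ⟨rfl, -⟩
      · exact Or.inl hw
      · exact Or.inr hpD
    · rcases mem_or_mem_boundary hD hv hvw with hw | hw
      · exact Or.inr hw
      · exact Or.inl hw.1
  have hDuniv : D = Set.univ := by
    ext x
    refine ⟨fun _ => Set.mem_univ _, fun _ => ?_⟩
    rcases huniv.ge (Set.mem_univ (x : V)) with hx | ⟨x', hx', hxx'⟩
    · exact absurd hx x.2
    · exact Subtype.ext hxx' ▸ hx'
  have hred := hc.reduction_singleton (Set.mem_range_self i) hi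
  have hE := three_le_numEdges_induce_range h
  rcases hD.2 with ⟨⟨d⟩⟩ | ⟨⟨d⟩⟩
  · obtain ⟨g, hg⟩ := nonempty_iso_induce_iff.1 ⟨(induceImageIso G D).trans d⟩
    obtain ⟨g', hg', hgz⟩ := exists_triangle_apply_eq g 0 (hg.symm ▸ hpD : z ∈ Set.range g)
    obtain ⟨h', hh', hhy⟩ := exists_triangle_apply_eq h 2 hp.1
    have hgr (j) : g' j ∉ Set.range h := by
      obtain ⟨x, -, hx⟩ := (hg'.trans hg).le ⟨j, rfl⟩
      exact hx ▸ x.2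
    have hhr (j) : h' j ∈ Set.range h := hh'.le ⟨j, rfl⟩
    have hdisj : ∀ i j, h' i ≠ g' j := fun i j hij => hgr j (hij ▸ hhr i)
    have hadj : ∀ i j, G.Adj (h' i) (g' j) ↔ i = 2 ∧ j = 0 := by
      refine fun i j => ⟨fun hij => ?_, ?_⟩
      · have hmem : (h' i, g' j) ∈ boundary G (Set.range h) := ⟨hhr i, hgr j, hij⟩
        obtain ⟨h1, h2⟩ := Prod.mk.inj (hsub hmem)
        exact ⟨h'.injective (h1.trans hhy.symm), g'.injective (h2.trans hgz.symm)⟩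
      · rintro ⟨rfl, rfl⟩
        rw [hgz, hhy]
        exact hp.2.2
    have hrange := range_chainEmbedding h' g' hdisj hadj
    rw [hh', hg', hg, huniv] at hrange
    have hlG : 1 ≤ lambda G := one_le_lambda (D := Set.univ)
      ⟨fun _ _ y _ => Set.mem_univ y, Or.inr (nonempty_iso_induce_iff.2 ⟨_, hrange⟩)⟩
    rw [hB, ncard_range_triangle h] at hred
    have hE' := mul_le_mul_of_nonneg_left (Nat.cast_le (α := ℝ).2 hE) hc.b_pos.le
    have hl' := mul_le_mul_of_nonneg_left (Nat.cast_le (α := ℝ).2 hlG) hc.b_pos.le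
    push_cast at hred hE' hl'
    linarith
  · let f : chainGraph ↪g G.induce (Set.range h)ᶜ := d.symm.toEmbedding.trans (Embedding.induce D)
    have hα := card_add_indepNum_induce_compl_le (G := G) (A := {h i}) (X := Set.range h)
      (by simp [IsIndepSet]) (by simp) (by simpa using hi)
    rw [Finset.card_singleton] at hα
    have hα' := two_le_indepNum_of_embedding f
    have hE' := numEdges_le_of_embedding f
    rw [numEdges_chainGraph] at hE'
    have hEG := numEdges_induce_add_le G (Set.range h)
    have hn := Set.ncard_add_ncard_compl (Set.range h)
    have hn' : (Set.range h)ᶜ.ncard = 6 := by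
      rw [← Nat.card_coe_set_eq, ← Set.ncard_univ, ← hDuniv, ← Nat.card_coe_set_eq,
        Nat.card_congr d.toEquiv, Nat.card_fin]
    rw [ncard_range_triangle h, hn'] at hn
    have h11 : (11 : ℝ) ≤ numEdges G := by exact_mod_cast (by omega : 11 ≤ numEdges G)
    have h3 : (3 : ℝ) ≤ indepNum G := by exact_mod_cast (by omega : 3 ≤ indepNum G)
    have hlt := hc.lt
    rw [← hn] at hlt
    have := mul_le_mul_of_nonneg_left h11 hc.b_pos.le
    have : 0 ≤ b * lambda G := mul_nonneg hc.b_pos.le (Nat.cast_nonneg _)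
    push_cast at hlt
    linarith

lemma two_mul_lambda_le [Finite V] (hc : IsMinCex a b G) (hab : 3 * a + 4 * b ≥ 2)
    (hab' : 9 * a + 11 * b ≥ 6) {X : Set V} (hne : X.Nonempty) :
    2 * lambda (G.induce Xᶜ) ≤ (boundary G X).ncard := by
  refine mul_lambda_induce_compl_le fun D hD => ?_
  obtain ⟨p, hp, hpD⟩ := hc.exists_mem_boundary hne hD
  by_cases hq : ∃ q ∈ boundary G X, q.2 ∈ Subtype.val '' D ∧ p ≠ q
  · obtain ⟨q, hq, hqD, hpq⟩ := hq
    refine ⟨![p, q], ?_, ?_⟩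
    · intro i j
      fin_cases i <;> fin_cases j <;> simp [hpq, hpq.symm]
    · intro i
      fin_cases i
      · exact ⟨hp, hpD⟩
      · exact ⟨hq, hqD⟩
  · push Not at hq
    exfalso
    rcases hD.exists_embedding with ⟨g, hg⟩ | ⟨g, hg⟩
    · refine hc.not_leaf_triangle hab hab' g p.2 p.1 fun i n hn => ?_
      have hgi : g i ∈ Subtype.val '' D := hg ▸ ⟨i, rfl⟩
      refine (mem_or_mem_boundary hD hgi hn).imp (fun h => hg ▸ h) fun h => ?_
      rw [hq _ h hgi]
      exact ⟨rfl, rfl⟩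
    · have key (j : Fin 6) (n : V) (hn : G.Adj (g j) n) :
          (∃ k, chainGraph.Adj j k ∧ g k = n) ∨ p = (n, g j) := by
        have hgj : g j ∈ Subtype.val '' D := hg ▸ ⟨j, rfl⟩
        refine (mem_or_mem_boundary hD hgj hn).imp (fun h => ?_) fun h => hq _ h hgj
        rw [← hg] at h
        obtain ⟨k, rfl⟩ := h
        exact ⟨k, g.map_rel_iff.1 hn, rfl⟩
      by_cases hpl : ∃ i, p.2 = g (chainTriangleLeft i)
      · obtain ⟨i', hi'⟩ := hpl
        refine hc.not_leaf_triangle hab hab' (chainTriangleRight.trans g) (g 3) (g 2)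
          fun i n hn => ?_
        rcases key _ n hn with ⟨k, hk, rfl⟩ | rfl
        · have : (∃ j, chainTriangleRight j = k) ∨ k = 2 ∧ chainTriangleRight i = 3 := by
            clear hn
            revert i k
            decide
          exact this.imp (fun ⟨j, hj⟩ => ⟨j, congrArg g hj⟩)
            fun h => ⟨congrArg g h.1, congrArg g h.2⟩
        · have hne : ∀ i j, chainTriangleRight i ≠ chainTriangleLeft j := by decide
          exact absurd (g.injective hi') (hne i i')
      · refine hc.not_leaf_triangle hab hab' (chainTriangleLeft.trans g) (g 2) (g 3)
          fun i n hn => ?_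
        rcases key _ n hn with ⟨k, hk, rfl⟩ | rfl
        · have : (∃ j, chainTriangleLeft j = k) ∨ k = 3 ∧ chainTriangleLeft i = 2 := by
            clear hn
            revert i k
            decide
          exact this.imp (fun ⟨j, hj⟩ => ⟨j, congrArg g hj⟩)
            fun h => ⟨congrArg g h.1, congrArg g h.2⟩
        · exact absurd ⟨i, rfl⟩ hpl

/-- Every vertex of a triangle has a neighbour outside the triangle. -/
lemma exists_adj_notMem_triangle [Finite V] (hc : IsMinCex a b G) (hab : 3 * a + 4 * b ≥ 2)
    (hab' : 9 * a + 11 * b ≥ 6) (h : (⊤ : SimpleGraph (Fin 3)) ↪g G) (i : Fin 3) :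
    ∃ n, G.Adj (h i) n ∧ n ∉ Set.range h := by
  by_contra! hi
  obtain ⟨h1, h2⟩ := hc.ncard_boundary_eq_of_triangle hab h hi
  have := hc.two_mul_lambda_le hab hab' (X := Set.range h) ⟨h i, i, rfl⟩
  omega

lemma three_mul_lambda_le [Finite V] (hc : IsMinCex a b G) (hab : 3 * a + 4 * b ≥ 2)
    (hab' : 9 * a + 11 * b ≥ 6) (X : Set V) :
    3 * lambda (G.induce Xᶜ) ≤ (boundary G X).ncard := by
  refine mul_lambda_induce_compl_le fun D hD => ?_
  suffices ∃ s : Fin 3 → V, s.Injective ∧ ∀ i, s i ∈ Subtype.val '' D ∧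
      ∃ n, (n, s i) ∈ boundary G X by
    obtain ⟨s, hs, hsD⟩ := this
    choose hsD n hn using hsD
    exact ⟨fun i => (n i, s i), fun i j hij => hs (Prod.mk.inj hij).2, fun i => ⟨hn i, hsD i⟩⟩
  rcases hD.exists_embedding with ⟨g, hg⟩ | ⟨g, hg⟩
  · refine ⟨g, g.injective, fun i => ?_⟩
    have hgi : g i ∈ Subtype.val '' D := hg ▸ ⟨i, rfl⟩
    obtain ⟨n, hn, hng⟩ := hc.exists_adj_notMem_triangle hab hab' g i
    exact ⟨hgi, n, (mem_or_mem_boundary hD hgi hn).resolve_left (hg ▸ hng)⟩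
  · refine ⟨g ∘ ![0, 1, 4], g.injective.comp (by decide), fun i => ?_⟩
    have hgi : g (![0, 1, 4] i) ∈ Subtype.val '' D := hg ▸ ⟨_, rfl⟩
    refine ⟨hgi, ?_⟩
    have key : (∃ j, chainTriangleLeft j = ![0, 1, 4] i ∧
          ∀ k, chainGraph.Adj (![0, 1, 4] i) k → ∃ j, chainTriangleLeft j = k) ∨
        ∃ j, chainTriangleRight j = ![0, 1, 4] i ∧
          ∀ k, chainGraph.Adj (![0, 1, 4] i) k → ∃ j, chainTriangleRight j = k := by
      clear hgi
      revert i
      decide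
    have aux (t : (⊤ : SimpleGraph (Fin 3)) ↪g chainGraph) (ht : ∃ j, t j = ![0, 1, 4] i ∧
        ∀ k, chainGraph.Adj (![0, 1, 4] i) k → ∃ j, t j = k) :
        ∃ n, (n, g (![0, 1, 4] i)) ∈ boundary G X := by
      obtain ⟨j, hj, ht⟩ := ht
      obtain ⟨n, hn, hng⟩ := hc.exists_adj_notMem_triangle hab hab' (t.trans g) j
      replace hn : G.Adj (g (![0, 1, 4] i)) n := hj ▸ hn
      refine ⟨n, (mem_or_mem_boundary hD hgi hn).resolve_left fun hnD => ?_⟩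
      rw [← hg] at hnD
      obtain ⟨k, rfl⟩ := hnD
      obtain ⟨l, rfl⟩ := ht k (g.map_rel_iff.1 hn)
      exact hng ⟨l, rfl⟩
    exact key.elim (aux _) (aux _)

lemma neighborSet_ne_empty [Finite V] (hc : IsMinCex a b G) (v : V) : G.neighborSet v ≠ ∅ := by
  intro hv
  have hred := hc.reduction_singleton (X := {v}) rfl fun w hw =>
    absurd (hv ▸ hw : w ∈ (∅ : Set V)) (Set.notMem_empty w)
  have hle := hc.lambda_le_ncard_boundary (X := {v}) ⟨v, rfl⟩
  have hle' := mul_le_mul_of_nonneg_left (Nat.cast_le (α := ℝ).2 hle) hc.b_pos.le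
  have h1 := mul_nonneg hc.b_pos.le (Nat.cast_nonneg (α := ℝ) (lambda G))
  have h2 := mul_nonneg hc.b_pos.le (Nat.cast_nonneg (α := ℝ) (numEdges (G.induce {v})))
  have := hc.a_pos
  rw [Set.ncard_singleton] at hred
  push_cast at hred
  linarith

lemma neighborSet_ne_singleton [Finite V] (hc : IsMinCex a b G) (hab : 2 * a + b ≥ 1) (v u : V) :
    G.neighborSet v ≠ {u} := by
  intro hv
  have hvu : G.Adj v u := hv.ge rfl
  have hred := hc.reduction_singleton (v := v) (X := {v, u}) (Or.inl rfl) fun w hw =>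
    Or.inr (hv.le hw)
  have hle := hc.lambda_le_ncard_boundary (X := {v, u}) ⟨v, Or.inl rfl⟩
  have hle' := mul_le_mul_of_nonneg_left (Nat.cast_le (α := ℝ).2 hle) hc.b_pos.le
  have hE := card_le_numEdges_induce (G := G) (X := {v, u}) {s(v, u)} (by simp [hvu])
  have hE' := mul_le_mul_of_nonneg_left (Nat.cast_le (α := ℝ).2 hE) hc.b_pos.le
  have h1 := mul_nonneg hc.b_pos.le (Nat.cast_nonneg (α := ℝ) (lambda G))
  rw [Set.ncard_pair hvu.ne] at hred
  rw [Finset.card_singleton] at hE'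
  push_cast at hred hE'
  linarith

lemma exists_adj_ne [Finite V] (hc : IsMinCex a b G) (hab : 2 * a + b ≥ 1) {v u : V}
    (hvu : G.Adj v u) : ∃ w, G.Adj v w ∧ w ≠ u := by
  by_contra! h
  exact hc.neighborSet_ne_singleton hab v u (Set.Subset.antisymm h (by simpa))

lemma neighborSet_ne_pair [Finite V] (hc : IsMinCex a b G) (hab : 2 * a + b ≥ 1)
    (hab' : 3 * a + 4 * b ≥ 2) (hab'' : 9 * a + 11 * b ≥ 6) (v : V) {u w : V} (huw : u ≠ w) :
    G.neighborSet v ≠ {u, w} := by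
  classical
  intro hv
  have hvu : G.Adj v u := hv.ge (Or.inl rfl)
  have hvw : G.Adj v w := hv.ge (Or.inr rfl)
  have hN : ∀ n, G.Adj v n → n ∈ ({v, u, w} : Set V) := fun n hn => Or.inr (hv.le hn)
  by_cases hadj : G.Adj u w
  · obtain ⟨n, hn, hnr⟩ :=
      hc.exists_adj_notMem_triangle hab' hab'' (triangleEmbedding hvu hvw hadj) 0
    rw [range_triangleEmbedding] at hnr
    exact hnr (hN n hn)
  have hred := hc.reduction_singleton (v := v) (X := {v, u, w}) (Or.inl rfl) hN
  have hle := hc.three_mul_lambda_le hab' hab'' {v, u, w}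
  obtain ⟨u', hu', huv'⟩ := hc.exists_adj_ne hab hvu.symm
  obtain ⟨w', hw', hwv'⟩ := hc.exists_adj_ne hab hvw.symm
  have hB : 2 ≤ (boundary G {v, u, w}).ncard := by
    have hne : (u, u') ≠ (w, w') := fun h => huw (Prod.mk.inj h).1
    rw [← Set.ncard_pair hne]
    refine Set.ncard_le_ncard ?_
    rintro p (rfl | rfl)
    · refine ⟨by simp, ?_, hu'⟩
      rintro (h | h | h)
      · exact huv' h
      · exact hu'.ne' h
      · exact hadj (h ▸ hu')
    · refine ⟨by simp, ?_, hw'⟩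
      rintro (h | h | h)
      · exact hwv' h
      · exact hadj (h ▸ hw'.symm : G.Adj u w)
      · exact hw'.ne' h
  have hle' : lambda (G.induce {v, u, w}ᶜ) + 2 ≤ (boundary G {v, u, w}).ncard := by omega
  have hle'' := mul_le_mul_of_nonneg_left (Nat.cast_le (α := ℝ).2 hle') hc.b_pos.le
  have hE := card_le_numEdges_induce (G := G) (X := {v, u, w}) {s(v, u), s(v, w)}
    (by simp [hvu, hvw])
  rw [Finset.card_pair (by simp [huw, hvw.ne])] at hE
  have hE' := mul_le_mul_of_nonneg_left (Nat.cast_le (α := ℝ).2 hE) hc.b_pos.le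
  have h1 := mul_nonneg hc.b_pos.le (Nat.cast_nonneg (α := ℝ) (lambda G))
  rw [Set.ncard_eq_three.2 ⟨v, u, w, hvu.ne, hvw.ne, huw, rfl⟩] at hred
  push_cast at hred hE' hle''
  linarith

end IsMinCex

end MinCounterexample

/-- Claim 2.8: the minimum degree of a minimum counterexample is at least three. -/
theorem claim_min_degree_three
(a b : ℝ) (ha : 0 < a) (hb : 0 < b)
    (h1 : 2 * a + b ≥ 1) (h2 : 3 * a + 4 * b ≥ 2) (h3 : 9 * a + 11 * b ≥ 6)
    (h4 : a + 5 * b ≥ 1) (h5 : 4 * a + 9 * b ≥ 3) (h6 : 10 * a + 16 * b ≥ 7)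
    (h7 : 13 * a + 20 * b ≥ 8) (h8 : 5 * a + 14 * b ≥ 4)
    (h9 : a + (3 / 2) * b ≥ 2 / 3)
{V : Type} [Fintype V] (G : SimpleGraph V)
    (hG : ¬ HasTriangleAdjC4 G)
    (hcex : (indepNum G : ℝ) <
      (Nat.card V : ℝ) - (a * Nat.card V + b * numEdges G + b * lambda G))
    (hmin : ∀ (W : Type) [Fintype W] (G' : SimpleGraph W),
      Nat.card W < Nat.card V → ¬ HasTriangleAdjC4 G' →
      (indepNum G' : ℝ) ≥
        (Nat.card W : ℝ) - (a * Nat.card W + b * numEdges G' + b * lambda G')) :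
    ∀ v : V, 3 ≤ deg G v := by
  have hc : IsMinCex a b G := ⟨ha, hb, hG, hcex, hmin⟩
  intro v
  by_contra! hv
  have hdeg : deg G v = (G.neighborSet v).ncard := Nat.card_coe_set_eq _
  obtain h | h | h : deg G v = 0 ∨ deg G v = 1 ∨ deg G v = 2 := by omega
  · exact hc.neighborSet_ne_empty v ((Set.ncard_eq_zero).1 (hdeg ▸ h))
  · obtain ⟨u, hu⟩ := Set.ncard_eq_one.1 (hdeg ▸ h)
    exact hc.neighborSet_ne_singleton h1 v u hu
  · obtain ⟨u, w, huw, huw'⟩ := Set.ncard_eq_two.1 (hdeg ▸ h)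
    exact hc.neighborSet_ne_pair h1 h2 h3 v huw huw'

end Paper
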